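/- arXiv:1701.03545 — 7 statements merged into one kernel-verified Lean document; each statement's English description precedes it below -/
import Mathlib

section
/- Let d ≥ 2 be an integer, let s > 0, and let (λ_k)_{k≥0} be a nonincreasing sequence of positive real numbers such that λ_k·k^s → 1 as k → ∞. Define a(n) = λ_{k(d,n)} for n ≥ 1. Then lim_{n→∞} n^{s/d}·a(n) = (2/d!)^{s/d}. -/
/-- `C(d,k) = (2k+d)·(k+d−1)!/(k!·d!)`, the dimension of the space of spherical
polynomials of degree at most `k` on the sphere `S^d`, as a real number. -/
noncomputable def sphC (d k : ℕ) : ℝ :=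
  ((2 * k + d : ℕ) : ℝ) * (Nat.factorial (k + d - 1) : ℝ) /
    ((Nat.factorial k : ℝ) * (Nat.factorial d : ℝ))

open Filter Topology

/-- The ratio `(k+m)!/k!` is asymptotic to `k^m`. -/
theorem tendsto_factorial_add_div_factorial_div_pow (m : ℕ) :
    Tendsto (fun k : ℕ => ((k + m).factorial : ℝ) / (k.factorial : ℝ) / (k : ℝ) ^ m)
      atTop (𝓝 1) := by
  induction m with
  | zero =>
    refine tendsto_const_nhds.congr fun k => ?_
    have : (k.factorial : ℝ) ≠ 0 := by positivity
    simp [this]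
  | succ m ih =>
    have h : Tendsto (fun k : ℕ => 1 + ((m + 1 : ℕ) : ℝ) / (k : ℝ)) atTop (𝓝 (1 + 0)) :=
      tendsto_const_nhds.add (tendsto_const_div_atTop_nhds_zero_nat _)
    have hprod := ih.mul h
    rw [add_zero, mul_one] at hprod
    refine hprod.congr' ?_
    filter_upwards [eventually_gt_atTop 0] with k hk
    have hk' : (k : ℝ) ≠ 0 := by positivity
    have hf : (k.factorial : ℝ) ≠ 0 := by positivity
    rw [← add_assoc, Nat.factorial_succ]
    push_cast
    field_simp
    ring

theorem tendsto_sphC_div_pow {d : ℕ} (hd : 1 ≤ d) :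
    Tendsto (fun k : ℕ => sphC d k / (k : ℝ) ^ d) atTop (𝓝 (2 / (d.factorial : ℝ))) := by
  obtain ⟨m, rfl⟩ : ∃ m, d = m + 1 := ⟨d - 1, by omega⟩
  have h : Tendsto (fun k : ℕ => (2 + ((m + 1 : ℕ) : ℝ) / (k : ℝ)) / ((m + 1).factorial : ℝ))
      atTop (𝓝 ((2 + 0) / ((m + 1).factorial : ℝ))) :=
    (tendsto_const_nhds.add (tendsto_const_div_atTop_nhds_zero_nat _)).div_const _
  have hprod := h.mul (tendsto_factorial_add_div_factorial_div_pow m)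
  rw [add_zero, mul_one] at hprod
  refine hprod.congr' ?_
  filter_upwards [eventually_gt_atTop 0] with k hk
  have hk' : (k : ℝ) ≠ 0 := by positivity
  have hf : (k.factorial : ℝ) ≠ 0 := by positivity
  have hg : ((m + 1).factorial : ℝ) ≠ 0 := by positivity
  rw [sphC, show k + (m + 1) - 1 = k + m by omega]
  push_cast
  field_simp
  ring

theorem tendsto_sphC_pred_div_pow {d : ℕ} (hd : 1 ≤ d) :
    Tendsto (fun k : ℕ => sphC d (k - 1) / (k : ℝ) ^ d) atTop
      (𝓝 (2 / (d.factorial : ℝ))) := by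
  rw [← tendsto_add_atTop_iff_nat 1]
  have h := (tendsto_sphC_div_pow hd).mul ((tendsto_natCast_div_add_atTop (1 : ℝ)).pow d)
  rw [one_pow, mul_one] at h
  refine h.congr' ?_
  filter_upwards [eventually_gt_atTop 0] with k hk
  have hk' : (k : ℝ) ≠ 0 := by positivity
  rw [Nat.add_sub_cancel, div_pow]
  push_cast
  field_simp

theorem sphC_nonneg (d k : ℕ) : 0 ≤ sphC d k := by
  unfold sphC
  positivity

theorem tendsto_atTop_of_le_sphC {d : ℕ} {kf : ℕ → ℕ}
    (h : ∀ n : ℕ, 1 ≤ n → (n : ℝ) ≤ sphC d (kf n)) : Tendsto kf atTop atTop := by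
  rw [tendsto_atTop]
  intro K
  filter_upwards [eventually_ge_atTop 1, tendsto_natCast_atTop_atTop.eventually_gt_atTop
    (∑ j ∈ Finset.range K, sphC d j)] with n hn hK
  by_contra! hlt
  have := Finset.single_le_sum (f := sphC d) (fun j _ => sphC_nonneg d j)
    (Finset.mem_range.2 hlt)
  linarith [h n hn]

/-- Theorem 3.1: if `λ_k · k^s → 1`, then
`n^{s/d} · λ_{k(d,n)} → (2/d!)^{s/d}`, where `k(d,n)` is the unique `k` with
`C(d,k−1) < n ≤ C(d,k)` (with `C(d,−1) = 0`). -/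
theorem strong_equivalence_sobolev_sphere
    (d : ℕ) (hd : 2 ≤ d) (s : ℝ) (hs : 0 < s)
    (lam : ℕ → ℝ) (hpos : ∀ k, 0 < lam k)
    (hmono : ∀ j k : ℕ, j ≤ k → lam k ≤ lam j)
    (hlim : Filter.Tendsto (fun k : ℕ => lam k * (k : ℝ) ^ s) Filter.atTop (nhds 1))
    (kf : ℕ → ℕ)
    (hkf : ∀ n : ℕ, 1 ≤ n →
      (n : ℝ) ≤ sphC d (kf n) ∧ (0 < kf n → sphC d (kf n - 1) < (n : ℝ))) :
    Filter.Tendsto (fun n : ℕ => (n : ℝ) ^ (s / (d : ℝ)) * lam (kf n)) Filter.atTop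
      (nhds ((2 / (Nat.factorial d : ℝ)) ^ (s / (d : ℝ)))) := by
  have hd1 : 1 ≤ d := by omega
  have hk := tendsto_atTop_of_le_sphC fun n hn => (hkf n hn).1
  have hratio : Tendsto (fun n : ℕ => (n : ℝ) / (kf n : ℝ) ^ d) atTop
      (𝓝 (2 / (d.factorial : ℝ))) := by
    refine tendsto_of_tendsto_of_tendsto_of_le_of_le'
      ((tendsto_sphC_pred_div_pow hd1).comp hk) ((tendsto_sphC_div_pow hd1).comp hk) ?_ ?_
    · filter_upwards [eventually_ge_atTop 1, hk.eventually_gt_atTop 0] with n hn hkn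
      exact div_le_div_of_nonneg_right ((hkf n hn).2 hkn).le (by positivity)
    · filter_upwards [eventually_ge_atTop 1] with n hn
      exact div_le_div_of_nonneg_right (hkf n hn).1 (by positivity)
  have hprod := (hratio.rpow_const (p := s / d) (Or.inr (by positivity))).mul (hlim.comp hk)
  rw [mul_one] at hprod
  refine hprod.congr' ?_
  filter_upwards [hk.eventually_gt_atTop 0] with n hkn
  have hk0 : (0 : ℝ) < kf n := by exact_mod_cast hkn
  have hd0 : (d : ℝ) ≠ 0 := by positivity
  have hpow : ((kf n : ℝ) ^ d) ^ (s / (d : ℝ)) = (kf n : ℝ) ^ s := by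
    rw [← Real.rpow_natCast, ← Real.rpow_mul hk0.le, mul_div_cancel₀ _ hd0]
  have hs0 : (kf n : ℝ) ^ s ≠ 0 := (Real.rpow_pos_of_pos hk0 s).ne'
  simp only [Function.comp_apply]
  rw [Real.div_rpow (by positivity) (by positivity), hpow]
  field_simp
end

section
/- Let d ≥ 2 be an integer, let 0 < α < 1 and β > 0, and set γ = (2/d!)^{−α/d}. Define a(n) = exp(−β·k(d,n)^α) for n ≥ 1. Then lim_{n→∞} exp(β·γ·n^{α/d})·a(n) = 1. -/
theorem sphC_mul_eq {d : ℕ} (hd : 1 ≤ d) (k : ℕ) :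
    sphC d k * ((d.factorial : ℝ) / 2) =
      ((k : ℝ) + d / 2) * ((k + 1).ascFactorial (d - 1) : ℝ) := by
  have h : ((k + d - 1).factorial : ℝ) = k.factorial * ((k + 1).ascFactorial (d - 1) : ℝ) := by
    rw [Nat.add_sub_assoc hd]
    exact_mod_cast (Nat.factorial_mul_ascFactorial k (d - 1)).symm
  have hk : (k.factorial : ℝ) ≠ 0 := by positivity
  have hd' : (d.factorial : ℝ) ≠ 0 := by positivity
  rw [sphC, h]
  push_cast
  field_simp

theorem sphC_mul_le {d : ℕ} (hd : 1 ≤ d) (k : ℕ) :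
    sphC d k * ((d.factorial : ℝ) / 2) ≤ ((k : ℝ) + d) ^ d := by
  rw [sphC_mul_eq hd]
  have h : ((k + 1).ascFactorial (d - 1) : ℝ) ≤ ((k : ℝ) + d) ^ (d - 1) := by
    have h1 : (k + 1).ascFactorial (d - 1) ≤ (k + d) ^ (d - 1) :=
      (Nat.ascFactorial_le_pow_add k (d - 1)).trans (Nat.pow_le_pow_left (by omega) _)
    exact_mod_cast h1
  have hd0 : (0 : ℝ) ≤ d := d.cast_nonneg
  calc ((k : ℝ) + d / 2) * ((k + 1).ascFactorial (d - 1) : ℝ)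
      ≤ ((k : ℝ) + d) * ((k : ℝ) + d) ^ (d - 1) := by
        gcongr
        linarith
    _ = ((k : ℝ) + d) ^ d := by rw [← pow_succ', Nat.sub_add_cancel hd]

theorem pow_le_sphC_mul {d : ℕ} (hd : 1 ≤ d) (k : ℕ) :
    (k : ℝ) ^ d ≤ sphC d k * ((d.factorial : ℝ) / 2) := by
  rw [sphC_mul_eq hd]
  have h : (k : ℝ) ^ (d - 1) ≤ ((k + 1).ascFactorial (d - 1) : ℝ) := by
    have h1 : k ^ (d - 1) ≤ (k + 1).ascFactorial (d - 1) :=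
      (Nat.pow_le_pow_left k.le_succ _).trans (Nat.pow_succ_le_ascFactorial (k + 1) (d - 1))
    exact_mod_cast h1
  have hd0 : (0 : ℝ) ≤ d := d.cast_nonneg
  calc (k : ℝ) ^ d = k * (k : ℝ) ^ (d - 1) := by rw [← pow_succ', Nat.sub_add_cancel hd]
    _ ≤ ((k : ℝ) + d / 2) * ((k + 1).ascFactorial (d - 1) : ℝ) := by
        gcongr
        linarith

theorem tendsto_add_rpow_sub_rpow_atTop {α c : ℝ} (hα0 : 0 ≤ α) (hα1 : α < 1) (hc : 0 ≤ c) :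
    Filter.Tendsto (fun t : ℝ => (t + c) ^ α - t ^ α) Filter.atTop (nhds 0) := by
  have hlim : Filter.Tendsto (fun t : ℝ => α * c * t ^ (-(1 - α))) Filter.atTop (nhds 0) := by
    simpa using (tendsto_rpow_neg_atTop (sub_pos.2 hα1)).const_mul (α * c)
  refine squeeze_zero' ?_ ?_ hlim
  · filter_upwards [Filter.eventually_ge_atTop 0] with t ht
    exact sub_nonneg.2 (Real.rpow_le_rpow ht (by linarith) hα0)
  · filter_upwards [Filter.eventually_gt_atTop 0] with t ht
    have hs : 0 ≤ c / t := by positivity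
    have h1 : (1 + c / t) ^ α ≤ 1 + α * (c / t) :=
      rpow_one_add_le_one_add_mul_self (by linarith) hα0 hα1.le
    have h2 : (t + c) ^ α = t ^ α * (1 + c / t) ^ α := by
      rw [← Real.mul_rpow ht.le (by linarith)]
      congr 1
      field_simp
    have h3 : t ^ (-(1 - α)) = t ^ α / t := by
      rw [neg_sub, Real.rpow_sub_one ht.ne']
    rw [h2, h3]
    calc t ^ α * (1 + c / t) ^ α - t ^ α
        ≤ t ^ α * (1 + α * (c / t)) - t ^ α := by gcongr
      _ = α * c * (t ^ α / t) := by ring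

/-- Theorem 3.3: for `0 < α < 1`, `β > 0` and `γ = (2/d!)^{−α/d}`, the sequence
`a(n) = exp(−β·k(d,n)^α)` satisfies `exp(β·γ·n^{α/d})·a(n) → 1`, where `k(d,n)` is
the unique `k` with `C(d,k−1) < n ≤ C(d,k)` (with `C(d,−1) = 0`). -/
theorem strong_equivalence_gevrey_sphere
    (d : ℕ) (hd : 2 ≤ d) (α β : ℝ) (hα0 : 0 < α) (hα1 : α < 1) (hβ : 0 < β)
    (γ : ℝ) (hγ : γ = (2 / (Nat.factorial d : ℝ)) ^ (-(α / (d : ℝ))))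
    (kf : ℕ → ℕ)
    (hkf : ∀ n : ℕ, 1 ≤ n →
      (n : ℝ) ≤ sphC d (kf n) ∧ (0 < kf n → sphC d (kf n - 1) < (n : ℝ))) :
    Filter.Tendsto
      (fun n : ℕ => Real.exp (β * γ * (n : ℝ) ^ (α / (d : ℝ))) *
        Real.exp (-β * (kf n : ℝ) ^ α))
      Filter.atTop (nhds 1) := by
  have hd1 : 1 ≤ d := by omega
  have hd0 : (d : ℝ) ≠ 0 := by positivity
  have hf1 : (1 : ℝ) ≤ (d.factorial : ℝ) / 2 := by
    have h : 2 ≤ d.factorial := hd.trans d.self_le_factorial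
    have h' : (2 : ℝ) ≤ d.factorial := by exact_mod_cast h
    linarith
  have hupper : ∀ n : ℕ, 1 ≤ n → (n : ℝ) * ((d.factorial : ℝ) / 2) ≤ ((kf n : ℝ) + d) ^ d :=
    fun n hn => (mul_le_mul_of_nonneg_right (hkf n hn).1 (by positivity)).trans
      (sphC_mul_le hd1 _)
  have hkN : Filter.Tendsto kf Filter.atTop Filter.atTop := by
    refine Filter.tendsto_atTop.2 fun M => ?_
    filter_upwards [Filter.eventually_gt_atTop ((M + d) ^ d)] with n hn
    by_contra! hlt
    have h1 : (n : ℝ) ≤ ((kf n : ℝ) + d) ^ d :=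
      (le_mul_of_one_le_right n.cast_nonneg hf1).trans (hupper n (by omega))
    have h2 : n ≤ (kf n + d) ^ d := by exact_mod_cast h1
    have h3 : (kf n + d) ^ d ≤ (M + d) ^ d := Nat.pow_le_pow_left (by omega) d
    omega
  have hk : Filter.Tendsto (fun n => (kf n : ℝ)) Filter.atTop Filter.atTop :=
    tendsto_natCast_atTop_atTop.comp hkN
  have hγn : ∀ n : ℕ, γ * (n : ℝ) ^ (α / (d : ℝ)) =
      ((n : ℝ) * ((d.factorial : ℝ) / 2)) ^ (α / (d : ℝ)) := fun n => by
    rw [hγ, Real.rpow_neg (by positivity), ← Real.inv_rpow (by positivity), inv_div,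
      Real.mul_rpow (by positivity) (by positivity), mul_comm]
  have hpow : ∀ y : ℝ, 0 ≤ y → (y ^ d) ^ (α / (d : ℝ)) = y ^ α := fun y hy => by
    rw [← Real.rpow_natCast y d, ← Real.rpow_mul hy, mul_div_cancel₀ _ hd0]
  have hexp : 0 ≤ α / (d : ℝ) := by positivity
  have hdiff : Filter.Tendsto
      (fun n : ℕ => γ * (n : ℝ) ^ (α / (d : ℝ)) - (kf n : ℝ) ^ α) Filter.atTop (nhds 0) := by
    have hup := (tendsto_add_rpow_sub_rpow_atTop hα0.le hα1 d.cast_nonneg).comp hk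
    have hlow := ((tendsto_add_rpow_sub_rpow_atTop hα0.le hα1 zero_le_one).comp
      (Filter.tendsto_atTop_add_const_right _ (-1) hk)).neg
    rw [neg_zero] at hlow
    refine tendsto_of_tendsto_of_tendsto_of_le_of_le' hlow hup ?_ ?_
    · filter_upwards [hkN.eventually_ge_atTop 1, Filter.eventually_ge_atTop 1] with n hkn hn
      have h1 : ((kf n - 1 : ℕ) : ℝ) ^ d ≤ (n : ℝ) * ((d.factorial : ℝ) / 2) :=
        (pow_le_sphC_mul hd1 _).trans
          (mul_le_mul_of_nonneg_right ((hkf n hn).2 hkn).le (by positivity))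
      have h2 := Real.rpow_le_rpow (by positivity) h1 hexp
      rw [hpow _ (Nat.cast_nonneg _), ← hγn, Nat.cast_sub hkn, Nat.cast_one] at h2
      simp only [Function.comp_apply, ← sub_eq_add_neg, sub_add_cancel]
      linarith
    · filter_upwards [Filter.eventually_ge_atTop 1] with n hn
      have h2 := Real.rpow_le_rpow (by positivity) (hupper n hn) hexp
      rw [hpow _ (by positivity), ← hγn] at h2
      simp only [Function.comp_apply]
      linarith
  have h := (Real.continuous_exp.tendsto _).comp (hdiff.const_mul β)
  rw [mul_zero, Real.exp_zero] at h
  refine h.congr fun n => ?_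
  rw [Function.comp_apply, ← Real.exp_add]
  congr 1
  ring
end

section
/- There exist absolute constants c > 0 and C > 0 such that for all integers d ≥ 2, all integers m with 2 ≤ m ≤ d, and all integers n with C(d,m−1) < n ≤ C(d,m), one has c·(ln n)/(1 + ln(d/ln n)) ≤ m ≤ C·(ln n)/(1 + ln(d/ln n)). -/
lemma sphC_mul_add (d k : ℕ) (hd : 0 < d) :
    sphC d k * ((d : ℝ) + k) = (2 * k + d) * ((d + k).choose k : ℝ) := by
  have h : ((d + k).choose k : ℝ) * d.factorial * k.factorial
      = ((d : ℝ) + k) * (k + d - 1).factorial := by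
    rw [Nat.add_comm k d]
    exact_mod_cast (Nat.add_choose_mul_factorial_mul_factorial d k).trans
      (Nat.mul_factorial_pred (by omega)).symm
  have hkf : (k.factorial : ℝ) ≠ 0 := by positivity
  have hdf : (d.factorial : ℝ) ≠ 0 := by positivity
  unfold sphC
  push_cast
  rw [div_mul_eq_mul_div, div_eq_iff (by positivity)]
  linear_combination -(2 * (k : ℝ) + d) * h

lemma choose_le_sphC (d k : ℕ) (hd : 0 < d) : ((d + k).choose k : ℝ) ≤ sphC d k := by
  have hd' : (0 : ℝ) < d := by exact_mod_cast hd
  have hpos : (0 : ℝ) < d + k := by positivity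
  refine le_of_mul_le_mul_right ?_ hpos
  rw [sphC_mul_add d k hd, mul_comm]
  gcongr ?_ * _
  linarith [(Nat.cast_nonneg k : (0 : ℝ) ≤ k)]

lemma sphC_le_two_mul_choose (d k : ℕ) (hd : 0 < d) :
    sphC d k ≤ 2 * ((d + k).choose k : ℝ) := by
  have hd' : (0 : ℝ) < d := by exact_mod_cast hd
  have hpos : (0 : ℝ) < d + k := by positivity
  refine le_of_mul_le_mul_right ?_ hpos
  rw [sphC_mul_add d k hd, mul_right_comm]
  gcongr ?_ * _
  linarith

lemma one_add_div_pow_le_choose (d j k : ℕ) (hk : k ≤ j) :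
    (1 + (d : ℝ) / j) ^ k ≤ ((d + k).choose k : ℝ) := by
  induction k with
  | zero => simp
  | succ k ih =>
    have h : ((d : ℝ) + k + 1) * ((d + k).choose k : ℝ)
        = ((d + (k + 1)).choose (k + 1) : ℝ) * (k + 1) := by
      exact_mod_cast Nat.add_one_mul_choose_eq (d + k) k
    have hle : (d : ℝ) / j ≤ d / (k + 1) := by
      gcongr
      exact_mod_cast hk
    have hstep : ((d + (k + 1)).choose (k + 1) : ℝ)
        = ((d + k).choose k : ℝ) * (1 + d / (k + 1)) := by
      field_simp
      linarith
    rw [hstep, pow_succ]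
    have := ih (by omega)
    gcongr

lemma choose_le_exp_mul_pow (d m : ℕ) (hm : 0 < m) :
    ((d + m).choose m : ℝ) ≤ Real.exp m * (1 + (d : ℝ) / m) ^ m := by
  have hm' : (0 : ℝ) < m := by exact_mod_cast hm
  have h1 : ((d + m).choose m : ℝ) ≤ ((d + m : ℕ) : ℝ) ^ m / m.factorial :=
    Nat.choose_le_pow_div m (d + m)
  have h2 := Real.pow_div_factorial_le_exp (x := (m : ℝ)) hm'.le m
  have h3 : ((d + m : ℕ) : ℝ) = m * (1 + d / m) := by
    push_cast
    field_simp
    ring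
  calc ((d + m).choose m : ℝ) ≤ ((d + m : ℕ) : ℝ) ^ m / m.factorial := h1
    _ = (m : ℝ) ^ m / m.factorial * (1 + d / m) ^ m := by rw [h3, mul_pow]; ring
    _ ≤ Real.exp m * (1 + (d : ℝ) / m) ^ m := by gcongr

lemma one_add_log_le_two_mul_log_one_add {r : ℝ} (hr : 0 < r) :
    1 + Real.log r ≤ 2 * Real.log (1 + r) := by
  have h : Real.log (Real.exp 1 * r) ≤ Real.log ((1 + r) ^ 2) := by
    apply Real.log_le_log (by positivity)
    nlinarith [Real.exp_one_lt_three, sq_nonneg (r - 1)]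
  rw [Real.log_mul (Real.exp_pos 1).ne' hr.ne', Real.log_exp, Real.log_pow] at h
  exact_mod_cast h

lemma log_one_add_le {r : ℝ} (hr : 1 ≤ r) :
    Real.log (1 + r) ≤ Real.log 2 + Real.log r := by
  rw [← Real.log_mul (by norm_num) (by positivity)]
  exact Real.log_le_log (by positivity) (by linarith)

/-- Lower bound for `log n` when `n` exceeds the dimension `C(d,m-1)`. -/
lemma mul_one_add_log_le_four_mul_log {d m n : ℕ} (hm : 2 ≤ m) (hmd : m ≤ d)
    (hn : sphC d (m - 1) < (n : ℝ)) :
    (m : ℝ) * (1 + Real.log ((d : ℝ) / m)) ≤ 4 * Real.log n := by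
  have hm0 : (2 : ℝ) ≤ m := by exact_mod_cast hm
  have hd0 : (0 : ℝ) < d := by exact_mod_cast (by omega : 0 < d)
  have hr : (0 : ℝ) < (d : ℝ) / m := by positivity
  have h1 : (1 + (d : ℝ) / m) ^ (m - 1) ≤ n :=
    ((one_add_div_pow_le_choose d m (m - 1) (by omega)).trans
      (choose_le_sphC d (m - 1) (by omega))).trans hn.le
  have h2 := Real.log_le_log (by positivity) h1
  rw [Real.log_pow, Nat.cast_sub (by omega), Nat.cast_one] at h2
  have h3 := one_add_log_le_two_mul_log_one_add hr
  have h4 : 0 ≤ Real.log (1 + (d : ℝ) / m) := Real.log_nonneg (by linarith)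
  nlinarith

/-- Upper bound for `log n` when `n` is at most the dimension `C(d,m)`. -/
lemma log_le_three_mul_mul_one_add_log {d m n : ℕ} (hm : 2 ≤ m) (hmd : m ≤ d)
    (hn0 : 0 < n) (hn : (n : ℝ) ≤ sphC d m) :
    Real.log n ≤ 3 * (m * (1 + Real.log ((d : ℝ) / m))) := by
  have hm0 : (2 : ℝ) ≤ m := by exact_mod_cast hm
  have hr : (1 : ℝ) ≤ (d : ℝ) / m := by
    rw [one_le_div (by linarith)]
    exact_mod_cast hmd
  have hn0' : (0 : ℝ) < n := by exact_mod_cast hn0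
  have h1 : (n : ℝ) ≤ 2 * (Real.exp m * (1 + (d : ℝ) / m) ^ m) := by
    linarith [sphC_le_two_mul_choose d m (by omega), choose_le_exp_mul_pow d m (by omega)]
  have h2 := Real.log_le_log hn0' h1
  rw [Real.log_mul (by norm_num) (by positivity), Real.log_mul (by positivity) (by positivity),
    Real.log_exp, Real.log_pow] at h2
  have h3 := log_one_add_le hr
  have h4 := Real.log_nonneg hr
  have h5 := Real.log_two_lt_d9
  nlinarith

lemma log_le_two_mul_of_le_sphC {d m n : ℕ} (hd : 2 ≤ d) (hmd : m ≤ d)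
    (hn0 : 0 < n) (hn : (n : ℝ) ≤ sphC d m) : Real.log n ≤ 2 * d := by
  have hd0 : (2 : ℝ) ≤ d := by exact_mod_cast hd
  have hn0' : (0 : ℝ) < n := by exact_mod_cast hn0
  have h1 : ((d + m).choose m : ℝ) ≤ 2 ^ (d + d) := by
    exact_mod_cast (Nat.choose_le_two_pow (d + m) m).trans
      (Nat.pow_le_pow_right (by norm_num) (by omega))
  have h2 : (n : ℝ) ≤ 2 ^ (d + d + 1) := by
    rw [pow_succ]
    linarith [sphC_le_two_mul_choose d m (by omega)]
  have h3 := Real.log_le_log hn0' h2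
  rw [Real.log_pow] at h3
  push_cast at h3
  nlinarith [Real.log_two_lt_d9]

/-- If `L` is comparable to `m (1 + log (d/m))` and `L ≤ 2 d`, then `1 + log (d/L)` is
positive and comparable to `1 + log (d/m)`. -/
lemma one_add_log_div_bounds {d m L : ℝ} (hm : 0 < m) (hmd : m ≤ d) (hL : 0 < L)
    (hlow : m * (1 + Real.log (d / m)) ≤ 4 * L)
    (hup : L ≤ 3 * (m * (1 + Real.log (d / m)))) (hLd : L ≤ 2 * d) :
    0 < 1 + Real.log (d / L) ∧ 1 + Real.log (d / L) ≤ 3 * (1 + Real.log (d / m)) ∧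
      1 + Real.log (d / m) ≤ 8 * (1 + Real.log (d / L)) := by
  have hd : 0 < d := hm.trans_le hmd
  have hr : 0 ≤ Real.log (d / m) := Real.log_nonneg ((one_le_div hm).2 hmd)
  set s := 1 + Real.log (d / m) with hs
  have hs1 : 1 ≤ s := by linarith
  have hs0 : 0 < s := by linarith
  have l2 := Real.log_two_lt_d9
  have e1 : Real.log (d / L) = Real.log d - Real.log L := Real.log_div hd.ne' hL.ne'
  have e2 : s = 1 + (Real.log d - Real.log m) := by rw [hs, Real.log_div hd.ne' hm.ne']
  have g1 := Real.log_le_log (by positivity) hlow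
  have g2 := Real.log_le_log hL hup
  have g3 := Real.log_le_log hL hLd
  have l4 : Real.log 4 = 2 * Real.log 2 := by
    rw [show (4 : ℝ) = 2 ^ 2 by norm_num, Real.log_pow]
    norm_num
  have l3 : 5 * Real.log 3 ≤ 8 * Real.log 2 := by
    have := Real.log_le_log (by norm_num) (by norm_num : (3 : ℝ) ^ 5 ≤ 2 ^ 8)
    rw [Real.log_pow, Real.log_pow] at this
    exact_mod_cast this
  rw [Real.log_mul hm.ne' hs0.ne', Real.log_mul (by norm_num) hL.ne', l4] at g1
  rw [Real.log_mul (by norm_num) (by positivity), Real.log_mul hm.ne' hs0.ne'] at g2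
  rw [Real.log_mul (by norm_num) hd.ne'] at g3
  have k1 : 0 ≤ Real.log s := Real.log_nonneg hs1
  have k2 := Real.log_le_sub_one_of_pos (half_pos hs0)
  rw [Real.log_div hs0.ne' (by norm_num)] at k2
  refine ⟨by linarith, by linarith, by linarith⟩

/-- Equivalence (4.6): there are absolute constants `c, C > 0` such that for all
`d ≥ 2`, `2 ≤ m ≤ d` and `C(d,m−1) < n ≤ C(d,m)` one has
`m ≍ ln n / (1 + ln(d/ln n))`. -/
theorem preasymptotic_index_equivalence :
    ∃ c C : ℝ, 0 < c ∧ 0 < C ∧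
      ∀ d m n : ℕ, 2 ≤ d → 2 ≤ m → m ≤ d →
        sphC d (m - 1) < (n : ℝ) → (n : ℝ) ≤ sphC d m →
        c * (Real.log n / (1 + Real.log ((d : ℝ) / Real.log n))) ≤ (m : ℝ) ∧
        (m : ℝ) ≤ C * (Real.log n / (1 + Real.log ((d : ℝ) / Real.log n))) := by
  refine ⟨1 / 24, 12, by norm_num, by norm_num, fun d m n hd hm hmd hlow hup => ?_⟩
  have hm0 : (0 : ℝ) < m := by exact_mod_cast (by omega : 0 < m)
  have hmd' : (m : ℝ) ≤ d := by exact_mod_cast hmd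
  have hn0 : 0 < n := by
    have : (0 : ℝ) < n :=
      ((Nat.cast_nonneg _).trans (choose_le_sphC d (m - 1) (by omega))).trans_lt hlow
    exact_mod_cast this
  have b1 := mul_one_add_log_le_four_mul_log hm hmd hlow
  have b2 := log_le_three_mul_mul_one_add_log hm hmd hn0 hup
  have b3 := log_le_two_mul_of_le_sphC hd hmd hn0 hup
  have hr : 0 ≤ Real.log ((d : ℝ) / m) := Real.log_nonneg ((one_le_div hm0).2 hmd')
  have hL : 0 < Real.log n := by
    have : 0 < (m : ℝ) * (1 + Real.log ((d : ℝ) / m)) := by positivity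
    linarith
  obtain ⟨hD, hD1, hD2⟩ := one_add_log_div_bounds hm0 hmd' hL b1 b2 b3
  rw [← mul_div_assoc, ← mul_div_assoc, div_le_iff₀ hD, le_div_iff₀ hD]
  constructor
  · linarith [mul_le_mul_of_nonneg_left hD2 hm0.le]
  · linarith [mul_le_mul_of_nonneg_left hD1 hm0.le]
end

section
/- For all integers d ≥ 2, all integers m > d, and all integers n with C(d,m−1) < n ≤ C(d,m), one has m/d ≤ n^{1/d} ≤ 2e·m/d; in particular m ≍ d·n^{1/d} with absolute equivalence constants. -/
theorem div_pow_le_sphC (k j : ℕ) :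
    (((j + 1 : ℕ) : ℝ) / ((k + 2 : ℕ) : ℝ)) ^ (k + 2) ≤ sphC (k + 2) j := by
  have hfact : (j.factorial : ℝ) * ((j : ℝ) + 1) ^ (k + 1) ≤ ((j + (k + 1)).factorial : ℝ) := by
    exact_mod_cast Nat.factorial_mul_pow_le_factorial
  have hself : ((k + 2).factorial : ℝ) ≤ ((k : ℝ) + 2) ^ (k + 2) := by
    exact_mod_cast Nat.factorial_le_pow (k + 2)
  have hj : (0 : ℝ) < j.factorial := by positivity
  have hk : (0 : ℝ) < (k + 2).factorial := by positivity
  rw [sphC, show j + (k + 2) - 1 = j + (k + 1) by omega, div_pow]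
  push_cast
  rw [div_le_div_iff₀ (by positivity) (by positivity)]
  calc ((j : ℝ) + 1) ^ (k + 2) * (j.factorial * (k + 2).factorial)
      = ((j : ℝ) + 1) * (j.factorial * ((j : ℝ) + 1) ^ (k + 1)) * (k + 2).factorial := by ring
    _ ≤ (2 * (j : ℝ) + (k + 2)) * (j + (k + 1)).factorial * ((k : ℝ) + 2) ^ (k + 2) := by
        gcongr
        · linarith
        · linarith

theorem sphC_le_pow {k m : ℕ} (hm : k + 2 < m) :
    sphC (k + 2) m ≤ (2 * Real.exp 1 * m / ((k + 2 : ℕ) : ℝ)) ^ (k + 2) := by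
  have hmR : (k : ℝ) + 3 ≤ m := by exact_mod_cast hm
  have hk0 : (0 : ℝ) ≤ k := k.cast_nonneg
  have hfact : ((m + 1 + k).factorial : ℝ) ≤ m.factorial * (((m : ℝ) + 1) * (2 * m) ^ k) := by
    have h : (m + 1 + k).factorial ≤ (m + 1).factorial * (2 * m) ^ k := by
      rw [← Nat.factorial_mul_ascFactorial]
      gcongr
      exact (Nat.ascFactorial_le_pow_add _ _).trans (by gcongr; omega)
    rw [Nat.factorial_succ] at h
    have h' : ((m + 1 + k).factorial : ℝ) ≤ ((m : ℝ) + 1) * m.factorial * (2 * m) ^ k := by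
      exact_mod_cast h
    linarith
  have hexp : ((k : ℝ) + 2) ^ (k + 2) ≤ Real.exp 1 ^ (k + 2) * (k + 2).factorial := by
    have h := Real.pow_div_factorial_le_exp ((k + 2 : ℕ) : ℝ) (by positivity) (k + 2)
    rw [div_le_iff₀ (by positivity), ← Real.exp_one_pow] at h
    exact_mod_cast h
  have hquad : (2 * (m : ℝ) + (k + 2)) * (m + 1) ≤ (2 * m) ^ 2 := by nlinarith
  rw [sphC, show m + (k + 2) - 1 = m + 1 + k by omega, div_pow]
  push_cast
  rw [div_le_div_iff₀ (by positivity) (by positivity)]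
  calc (2 * (m : ℝ) + (k + 2)) * (m + 1 + k).factorial * ((k : ℝ) + 2) ^ (k + 2)
      ≤ (2 * (m : ℝ) + (k + 2)) * (m.factorial * (((m : ℝ) + 1) * (2 * m) ^ k)) *
          (Real.exp 1 ^ (k + 2) * (k + 2).factorial) := by gcongr
    _ = ((2 * (m : ℝ) + (k + 2)) * (m + 1)) *
          ((2 * m) ^ k * (Real.exp 1 ^ (k + 2) * (m.factorial * (k + 2).factorial))) := by ring
    _ ≤ (2 * (m : ℝ)) ^ 2 *
          ((2 * m) ^ k * (Real.exp 1 ^ (k + 2) * (m.factorial * (k + 2).factorial))) := by gcongr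
    _ = (2 * Real.exp 1 * m) ^ (k + 2) * (m.factorial * (k + 2).factorial) := by ring

/-- Equivalence (4.8): for all `d ≥ 2`, `m > d` and `C(d,m−1) < n ≤ C(d,m)` one has
`m/d ≤ n^{1/d} ≤ 2e·m/d`; in particular `m ≍ d·n^{1/d}` with absolute constants. -/
theorem asymptotic_index_equivalence
    (d m n : ℕ) (hd : 2 ≤ d) (hm : d < m)
    (h1 : sphC d (m - 1) < (n : ℝ)) (h2 : (n : ℝ) ≤ sphC d m) :
    (m : ℝ) / d ≤ (n : ℝ) ^ (1 / (d : ℝ)) ∧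
    (n : ℝ) ^ (1 / (d : ℝ)) ≤ 2 * Real.exp 1 * m / d := by
  obtain ⟨k, rfl⟩ := Nat.exists_eq_add_of_le' hd
  have hroot {x : ℝ} (hx : 0 ≤ x) : (x ^ (k + 2)) ^ (1 / ((k + 2 : ℕ) : ℝ)) = x := by
    rw [one_div]
    exact Real.pow_rpow_inv_natCast hx (by omega)
  constructor
  · have h := (div_pow_le_sphC k (m - 1)).trans h1.le
    rw [Nat.sub_add_cancel (by omega)] at h
    rw [← hroot (x := (m : ℝ) / ((k + 2 : ℕ) : ℝ)) (by positivity)]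
    gcongr
  · rw [← hroot (x := 2 * Real.exp 1 * m / ((k + 2 : ℕ) : ℝ)) (by positivity)]
    gcongr
    exact h2.trans (sphC_le_pow hm)
end

section
/- Let α > 0 and β > 0. For integers d ≥ 2 and ε ∈ (0,1) define n(ε,d) = min{n ∈ ℕ : exp(−β·k(d,n+1)^α) ≤ ε}. Then for all s > 0 and t > 0: for every δ > 0 there exists M > 0 such that for all integers d ≥ 2 and all ε ∈ (0,1) with ε^{−1} + d ≥ M, one has ln(n(ε,d)) ≤ δ·(ε^{−s} + d^t). That is, the problem is uniformly weakly tractable. -/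
/-- The information complexity `n(ε,d) = min{n ∈ ℕ : exp(−β·k(d,n+1)^α) ≤ ε}` of
the approximation problem `I_d : G^{α,β}(S^d) → L₂(S^d)` for the absolute error
criterion, via an index function `kf` with `kf d n = k(d,n)`. -/
noncomputable def infoComplexityGev (α β : ℝ) (d : ℕ) (kf : ℕ → ℕ → ℕ) (ε : ℝ) : ℕ :=
  sInf {n : ℕ | Real.exp (-β * (kf d (n + 1) : ℝ) ^ α) ≤ ε}

/-- `sphC d k` is a sum of two binomial coefficients. -/
theorem sphC_eq_choose_add_choose (d k : ℕ) (hd : 1 ≤ d) :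
    sphC d k = ((Nat.choose (k + d) d + Nat.choose (k + d - 1) d : ℕ) : ℝ) := by
  obtain ⟨e, rfl⟩ : ∃ e, d = e + 1 := ⟨d - 1, by omega⟩
  have hpos (m : ℕ) : (Nat.factorial m : ℝ) ≠ 0 := by positivity
  unfold sphC
  rw [div_eq_iff (mul_ne_zero (hpos k) (hpos _))]
  norm_cast
  have h₁ := Nat.add_choose_mul_factorial_mul_factorial k (e + 1)
  cases k with
  | zero =>
    simp [Nat.factorial_succ]
  | succ j =>
    have h₂ := Nat.add_choose_mul_factorial_mul_factorial j (e + 1)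
    have e₁ : j + 1 + (e + 1) - 1 = j + (e + 1) := by omega
    have e₂ : (j + 1 + (e + 1)).factorial = (j + 1 + (e + 1)) * (j + (e + 1)).factorial := by
      rw [show j + 1 + (e + 1) = (j + (e + 1)) + 1 by omega, Nat.factorial_succ]
    rw [e₂, Nat.factorial_succ j] at h₁
    rw [e₁, Nat.factorial_succ j]
    nlinarith [h₁, congrArg ((j + 1) * ·) h₂]

theorem sphC_mono {d : ℕ} (hd : 1 ≤ d) : Monotone (sphC d) := by
  intro a b hab
  rw [sphC_eq_choose_add_choose d a hd, sphC_eq_choose_add_choose d b hd, Nat.cast_le]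
  gcongr

/-- A power of the logarithm is dominated by any positive power, up to a constant. -/
theorem exists_log_rpow_le {r s η : ℝ} (hr : 0 ≤ r) (hs : 0 < s) (hη : 0 < η) :
    ∃ c : ℝ, ∀ x : ℝ, 1 ≤ x → Real.log x ^ r ≤ η * x ^ s + c := by
  obtain ⟨X, hX⟩ := Filter.eventually_atTop.1
    ((isLittleO_log_rpow_rpow_atTop r hs).bound hη)
  refine ⟨Real.log (max X 1) ^ r, ?_⟩
  intro x hx
  have hx0 : 0 < x := by linarith
  have hxs : 0 ≤ η * x ^ s := by positivity
  rcases le_total X x with h | h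
  · have hb := hX x h
    rw [Real.norm_of_nonneg (Real.rpow_nonneg hx0.le s)] at hb
    have := Real.rpow_nonneg (Real.log_nonneg (le_max_right X 1)) r
    linarith [Real.le_norm_self (Real.log x ^ r)]
  · have : Real.log x ^ r ≤ Real.log (max X 1) ^ r :=
      Real.rpow_le_rpow (Real.log_nonneg hx)
        (Real.log_le_log hx0 (h.trans (le_max_left _ _))) hr
    linarith

theorem log_choose_add_choose_le (d k : ℕ) (hd : 1 ≤ d) :
    Real.log ((Nat.choose (k + d) d + Nat.choose (k + d - 1) d : ℕ) : ℝ) ≤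
      1 + 2 * (k : ℝ) ^ 2 + Real.log d ^ 2 := by
  have hd' : (1 : ℝ) ≤ d := by exact_mod_cast hd
  have hN : Nat.choose (k + d) d + Nat.choose (k + d - 1) d ≤ 2 * ((k + 1) * d) ^ k := by
    have h₁ : Nat.choose (k + d - 1) d ≤ Nat.choose (k + d) d :=
      Nat.choose_le_choose d (Nat.sub_le _ _)
    have h₂ : Nat.choose (k + d) d ≤ (k + d) ^ k := by
      rw [← Nat.choose_symm_add]
      exact Nat.choose_le_pow _ _
    have h₃ : (k + d) ^ k ≤ ((k + 1) * d) ^ k := by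
      gcongr
      nlinarith
    omega
  have hpos : 0 < Nat.choose (k + d) d + Nat.choose (k + d - 1) d :=
    Nat.add_pos_left (Nat.choose_pos (Nat.le_add_left _ _)) _
  calc Real.log ((Nat.choose (k + d) d + Nat.choose (k + d - 1) d : ℕ) : ℝ)
      ≤ Real.log ((2 * ((k + 1) * d) ^ k : ℕ) : ℝ) :=
        Real.log_le_log (by exact_mod_cast hpos) (by exact_mod_cast hN)
    _ = Real.log 2 + k * (Real.log (k + 1) + Real.log d) := by
        push_cast
        rw [Real.log_mul (by norm_num) (by positivity), Real.log_pow,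
          Real.log_mul (by positivity) (by positivity)]
    _ ≤ 1 + k * (k + Real.log d) := by
        have h₁ := Real.log_le_sub_one_of_pos (show (0 : ℝ) < 2 by norm_num)
        have h₂ := Real.log_le_sub_one_of_pos (show (0 : ℝ) < (k : ℝ) + 1 by positivity)
        gcongr <;> linarith
    _ ≤ 1 + 2 * (k : ℝ) ^ 2 + Real.log d ^ 2 := by
        nlinarith [sq_nonneg ((k : ℝ) - Real.log d), sq_nonneg (k : ℝ), sq_nonneg (Real.log d)]

/-- If `k + 1` exceeds `(log ε⁻¹ / β) ^ (1 / α)`, then the information complexity at `ε` is at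
most `sphC d k`. -/
theorem infoComplexityGev_le {α β : ℝ} (hα : 0 < α) (hβ : 0 < β) {kf : ℕ → ℕ → ℕ} {d : ℕ}
    (hd : 1 ≤ d) (hkf : ∀ n : ℕ, 1 ≤ n → (n : ℝ) ≤ sphC d (kf d n)) {ε : ℝ}
    (hε : 0 < ε) (hε₁ : ε ≤ 1) {k : ℕ} (hk : (Real.log ε⁻¹ / β) ^ (1 / α) ≤ (k : ℝ) + 1) :
    infoComplexityGev α β d kf ε ≤ Nat.choose (k + d) d + Nat.choose (k + d - 1) d := by
  set N := Nat.choose (k + d) d + Nat.choose (k + d - 1) d with hN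
  refine Nat.sInf_le ?_
  have hlt : k < kf d (N + 1) := by
    by_contra! h
    have h₁ := (hkf (N + 1) (by omega)).trans (sphC_mono hd h)
    rw [sphC_eq_choose_add_choose d k hd, ← hN, Nat.cast_le] at h₁
    omega
  have hlt' : (k : ℝ) + 1 ≤ kf d (N + 1) := by exact_mod_cast hlt
  have hL : 0 ≤ Real.log ε⁻¹ / β :=
    div_nonneg (Real.log_nonneg ((one_le_inv₀ hε).2 hε₁)) hβ.le
  have hpow : Real.log ε⁻¹ / β ≤ (kf d (N + 1) : ℝ) ^ α := by
    calc Real.log ε⁻¹ / β = ((Real.log ε⁻¹ / β) ^ (1 / α)) ^ α := by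
          rw [← Real.rpow_mul hL, one_div_mul_cancel hα.ne', Real.rpow_one]
      _ ≤ _ := Real.rpow_le_rpow (Real.rpow_nonneg hL _) (hk.trans hlt') hα.le
  rw [div_le_iff₀ hβ, Real.log_inv] at hpow
  rw [Set.mem_ofPred_eq, ← Real.le_log_iff_exp_le hε]
  linarith

theorem log_infoComplexityGev_le {α β : ℝ} (hα : 0 < α) (hβ : 0 < β) {kf : ℕ → ℕ → ℕ} {d : ℕ}
    (hd : 1 ≤ d) (hkf : ∀ n : ℕ, 1 ≤ n → (n : ℝ) ≤ sphC d (kf d n)) {ε : ℝ}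
    (hε : 0 < ε) (hε₁ : ε ≤ 1) :
    Real.log (infoComplexityGev α β d kf ε) ≤
      1 + 2 * (β⁻¹ ^ (2 / α) * Real.log ε⁻¹ ^ (2 / α)) + Real.log d ^ 2 := by
  have hlog : 0 ≤ Real.log ε⁻¹ := Real.log_nonneg ((one_le_inv₀ hε).2 hε₁)
  have hL : 0 ≤ Real.log ε⁻¹ / β := div_nonneg hlog hβ.le
  set y := (Real.log ε⁻¹ / β) ^ (1 / α) with hy
  have hy0 : 0 ≤ y := Real.rpow_nonneg hL _
  have hy2 : y ^ 2 = β⁻¹ ^ (2 / α) * Real.log ε⁻¹ ^ (2 / α) := by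
    rw [hy, ← Real.rpow_natCast, ← Real.rpow_mul hL, div_eq_inv_mul (Real.log ε⁻¹),
      Real.mul_rpow (inv_nonneg.2 hβ.le) hlog]
    norm_num [div_eq_inv_mul, mul_comm]
  have hle := infoComplexityGev_le hα hβ hd hkf hε hε₁ (Nat.lt_floor_add_one y).le
  have hfl : (⌊y⌋₊ : ℝ) ^ 2 ≤ y ^ 2 := by
    gcongr
    exact Nat.floor_le hy0
  rcases Nat.eq_zero_or_pos (infoComplexityGev α β d kf ε) with h0 | hpos
  · rw [h0, Nat.cast_zero, Real.log_zero, ← hy2]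
    positivity
  · have h₁ := Real.log_le_log (by exact_mod_cast hpos) (Nat.cast_le (α := ℝ).2 hle)
    have h₂ := log_choose_add_choose_le d ⌊y⌋₊ hd
    rw [← hy2]
    linarith

/-- Theorem 5.2(1): for all `α, β > 0` the approximation problem
`I_d : G^{α,β}(S^d) → L₂(S^d)` is uniformly weakly tractable. -/
theorem gevrey_sphere_uniformly_weakly_tractable
    (α β : ℝ) (hα : 0 < α) (hβ : 0 < β)
    (kf : ℕ → ℕ → ℕ)
    (hkf : ∀ d : ℕ, 2 ≤ d → ∀ n : ℕ, 1 ≤ n →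
      (n : ℝ) ≤ sphC d (kf d n) ∧ (0 < kf d n → sphC d (kf d n - 1) < (n : ℝ))) :
    ∀ s t : ℝ, 0 < s → 0 < t →
      ∀ δ : ℝ, 0 < δ → ∃ M : ℝ, 0 < M ∧
        ∀ d : ℕ, 2 ≤ d → ∀ ε : ℝ, 0 < ε → ε < 1 → M ≤ ε⁻¹ + d →
          Real.log (infoComplexityGev α β d kf ε) ≤ δ * (ε ^ (-s) + (d : ℝ) ^ t) := by
  intro s t hs ht δ hδ
  obtain ⟨c₁, h₁⟩ := exists_log_rpow_le (r := 2 / α) (by positivity) hs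
    (show 0 < δ / (4 * β⁻¹ ^ (2 / α)) by positivity)
  obtain ⟨c₂, h₂⟩ := exists_log_rpow_le (r := 2) (by norm_num) ht (half_pos hδ)
  set c := 1 + 2 * β⁻¹ ^ (2 / α) * c₁ + c₂ with hc
  have hlarge {u : ℝ} (hu : 0 < u) : ∀ᶠ x : ℝ in Filter.atTop, c ≤ δ / 2 * x ^ u :=
    ((tendsto_rpow_atTop hu).const_mul_atTop (half_pos hδ)).eventually_ge_atTop c
  obtain ⟨X, hX⟩ := Filter.eventually_atTop.1 ((hlarge hs).and (hlarge ht))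
  refine ⟨2 * max X 1, by positivity, ?_⟩
  intro d hd ε hε hε₁ hM
  have hinv : 1 ≤ ε⁻¹ := (one_le_inv₀ hε).2 hε₁.le
  have hd₁ : (1 : ℝ) ≤ d := by exact_mod_cast (by omega : 1 ≤ d)
  have hlog := log_infoComplexityGev_le hα hβ (by omega : 1 ≤ d)
    (fun n hn => (hkf d hd n hn).1) hε hε₁.le
  have hεs : ε ^ (-s) = ε⁻¹ ^ s := by rw [Real.rpow_neg hε.le, Real.inv_rpow hε.le]
  have hA : 2 * (β⁻¹ ^ (2 / α) * Real.log ε⁻¹ ^ (2 / α)) ≤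
      δ / 2 * ε⁻¹ ^ s + 2 * β⁻¹ ^ (2 / α) * c₁ := by
    calc 2 * (β⁻¹ ^ (2 / α) * Real.log ε⁻¹ ^ (2 / α))
        ≤ 2 * (β⁻¹ ^ (2 / α) * (δ / (4 * β⁻¹ ^ (2 / α)) * ε⁻¹ ^ s + c₁)) := by
          gcongr
          exact h₁ _ hinv
      _ = _ := by
          field_simp
          ring
  have hB := h₂ d hd₁
  rw [Real.rpow_two] at hB
  have hps : 0 ≤ δ / 2 * ε⁻¹ ^ s := by positivity
  have hpt : 0 ≤ δ / 2 * (d : ℝ) ^ t := by positivity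
  have hC : c ≤ δ / 2 * ε⁻¹ ^ s + δ / 2 * (d : ℝ) ^ t := by
    rcases le_total X ε⁻¹ with h | h
    · linarith [(hX _ h).1]
    · have hXd : X ≤ d := by linarith [le_max_left X 1]
      linarith [(hX _ hXd).2]
  rw [hεs]
  linarith
end

section
/- Let α > 0 and β > 0. For integers d ≥ 2 and ε ∈ (0,1) define n(ε,d) = min{n ∈ ℕ : exp(−β·k(d,n+1)^α) ≤ ε}. Then for all constants c > 0, p ≥ 0, q ≥ 0 there exist an integer d ≥ 2 and ε ∈ (0,1) with n(ε,d) > c·d^q·ε^{−p}. That is, the problem is not polynomially tractable. -/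
theorem sphC_le_succ {d : ℕ} (hd : 1 ≤ d) (k : ℕ) : sphC d k ≤ sphC d (k + 1) := by
  obtain ⟨e, rfl⟩ : ∃ e, d = e + 1 := ⟨d - 1, by omega⟩
  unfold sphC
  have h1 : k + (e + 1) - 1 = k + e := by omega
  have h2 : k + 1 + (e + 1) - 1 = (k + e) + 1 := by omega
  rw [h1, h2, Nat.factorial_succ (k + e), Nat.factorial_succ k]
  rw [div_le_div_iff₀ (by positivity) (by positivity)]
  have key : ((2 * k + (e + 1) : ℕ) : ℝ) * ((k + 1 : ℕ) : ℝ)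
      ≤ ((2 * (k + 1) + (e + 1) : ℕ) : ℝ) * ((k + e + 1 : ℕ) : ℝ) := by
    exact_mod_cast Nat.mul_le_mul (by omega) (by omega)
  have hP : (0 : ℝ) ≤ ((k + e).factorial : ℝ) * k.factorial * (e + 1).factorial := by positivity
  have := mul_le_mul_of_nonneg_right key hP
  push_cast at this ⊢
  linarith

theorem pow_div_factorial_le_sphC {d : ℕ} (hd : 1 ≤ d) (k : ℕ) :
    (d : ℝ) ^ k / (k.factorial : ℝ) ≤ sphC d k := by
  unfold sphC
  rw [div_le_div_iff₀ (by positivity) (by positivity)]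
  have h : d ^ k * d.factorial ≤ (2 * k + d) * (k + d - 1).factorial :=
    calc d ^ k * d.factorial ≤ d.factorial * (d + 1) ^ k := by
          rw [mul_comm]
          exact Nat.mul_le_mul_left _ (Nat.pow_le_pow_left (Nat.le_succ d) k)
      _ ≤ (d + k).factorial := Nat.factorial_mul_pow_le_factorial
      _ = (k + d) * (k + d - 1).factorial := by
          rw [add_comm d k, Nat.mul_factorial_pred (by omega)]
      _ ≤ (2 * k + d) * (k + d - 1).factorial := Nat.mul_le_mul_right _ (by omega)
  have h' : (d : ℝ) ^ k * d.factorial ≤ ((2 * k + d : ℕ) : ℝ) * (k + d - 1).factorial := by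
    exact_mod_cast h
  have := mul_le_mul_of_nonneg_right h' (Nat.cast_nonneg (α := ℝ) k.factorial)
  linarith

/-- The information complexity at `ε = exp (-β (m + 1) ^ α)` exceeds `C(d,m) - 1`. -/
theorem sphC_lt_infoComplexityGev_add_one {α β : ℝ} (hα : 0 < α) (hβ : 0 < β)
    {d : ℕ} (hd : 1 ≤ d) {kf : ℕ → ℕ → ℕ}
    (hkf : ∀ n : ℕ, 1 ≤ n →
      (n : ℝ) ≤ sphC d (kf d n) ∧ (0 < kf d n → sphC d (kf d n - 1) < (n : ℝ))) (m : ℕ) :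
    sphC d m <
      (infoComplexityGev α β d kf (Real.exp (-β * ((m + 1 : ℕ) : ℝ) ^ α)) : ℝ) + 1 := by
  have hmem (n : ℕ) : Real.exp (-β * (kf d (n + 1) : ℝ) ^ α) ≤
      Real.exp (-β * ((m + 1 : ℕ) : ℝ) ^ α) ↔ m + 1 ≤ kf d (n + 1) := by
    rw [Real.exp_le_exp, neg_mul, neg_mul, neg_le_neg_iff, mul_le_mul_iff_right₀ hβ,
      Real.rpow_le_rpow_iff (by positivity) (by positivity) hα, Nat.cast_le]
  have hne : {n : ℕ | Real.exp (-β * (kf d (n + 1) : ℝ) ^ α) ≤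
      Real.exp (-β * ((m + 1 : ℕ) : ℝ) ^ α)}.Nonempty := by
    obtain ⟨n, hn⟩ := exists_nat_gt (sphC d m)
    refine ⟨n, (hmem n).2 ?_⟩
    by_contra! hlt
    have h1 := (hkf (n + 1) (by omega)).1
    have h2 := sphC_mono hd (Nat.lt_succ_iff.1 hlt)
    push_cast at h1
    linarith
  have hk := (hmem _).1 (Nat.sInf_mem hne)
  have h1 := (hkf _ (Nat.succ_pos _)).2 (lt_of_lt_of_le m.succ_pos hk)
  have h2 := sphC_mono hd (Nat.le_sub_of_add_le hk)
  unfold infoComplexityGev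
  exact h2.trans_lt (h1.trans_eq (Nat.cast_succ _))

/-- Theorem 5.2(2): for all `α, β > 0` the approximation problem
`I_d : G^{α,β}(S^d) → L₂(S^d)` is not polynomially tractable. -/
theorem gevrey_sphere_not_polynomially_tractable
    (α β : ℝ) (hα : 0 < α) (hβ : 0 < β)
    (kf : ℕ → ℕ → ℕ)
    (hkf : ∀ d : ℕ, 2 ≤ d → ∀ n : ℕ, 1 ≤ n →
      (n : ℝ) ≤ sphC d (kf d n) ∧ (0 < kf d n → sphC d (kf d n - 1) < (n : ℝ))) :
    ∀ c p q : ℝ, 0 < c → 0 ≤ p → 0 ≤ q →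
      ∃ d : ℕ, 2 ≤ d ∧ ∃ ε : ℝ, 0 < ε ∧ ε < 1 ∧
        c * (d : ℝ) ^ q * ε ^ (-p) < (infoComplexityGev α β d kf ε : ℝ) := by
  intro c p q hc _ hq
  set m : ℕ := ⌈q⌉₊ + 1
  set ε : ℝ := Real.exp (-β * ((m + 1 : ℕ) : ℝ) ^ α) with hε
  have hε0 : 0 < ε := Real.exp_pos _
  have hε1 : ε < 1 := by
    rw [hε, Real.exp_lt_one_iff, neg_mul, neg_lt_zero]
    positivity
  obtain ⟨N, hN⟩ := exists_nat_ge ((c * ε ^ (-p) + 1) * (m.factorial : ℝ))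
  set d : ℕ := max 2 N
  have hd : 2 ≤ d := le_max_left _ _
  refine ⟨d, hd, ε, hε0, hε1, ?_⟩
  have hd1 : (1 : ℝ) ≤ d := by exact_mod_cast one_le_two.trans hd
  have hdN : (c * ε ^ (-p) + 1) * (m.factorial : ℝ) ≤ d :=
    hN.trans (by exact_mod_cast le_max_right _ _)
  have hq1 : 1 ≤ (d : ℝ) ^ q := Real.one_le_rpow hd1 hq
  have hpow : (d : ℝ) ^ q * d ≤ (d : ℝ) ^ m := by
    rw [pow_succ]
    gcongr
    rw [← Real.rpow_natCast]
    exact Real.rpow_le_rpow_of_exponent_le hd1 (Nat.le_ceil q)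
  have hlow : c * (d : ℝ) ^ q * ε ^ (-p) + 1 ≤ (d : ℝ) ^ m / (m.factorial : ℝ) := by
    rw [le_div_iff₀ (by positivity)]
    calc (c * (d : ℝ) ^ q * ε ^ (-p) + 1) * (m.factorial : ℝ)
        ≤ (c * (d : ℝ) ^ q * ε ^ (-p) + (d : ℝ) ^ q) * (m.factorial : ℝ) := by gcongr
      _ = (d : ℝ) ^ q * ((c * ε ^ (-p) + 1) * (m.factorial : ℝ)) := by ring
      _ ≤ (d : ℝ) ^ q * d := by gcongr
      _ ≤ (d : ℝ) ^ m := hpow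
  have h1 := pow_div_factorial_le_sphC (one_le_two.trans hd) m
  have h2 := sphC_lt_infoComplexityGev_add_one hα hβ (one_le_two.trans hd) (hkf d hd) m
  linarith
end

section
/- Let d ≥ 1 be an integer, let s > 0, and let (λ_k)_{k≥0} be a nonincreasing sequence of positive real numbers such that λ_k·k^s → 1 as k → ∞. Define a(n) = λ_{k̃(d,n)} for n ≥ 1. Then lim_{n→∞} n^{s/d}·a(n) = (1/d!)^{s/d}. -/
/-- `D(d,k) = binom(k+d,d)`, the dimension of the space of polynomials of degree at
most `k` on the unit ball `B^d ⊂ ℝ^d`. -/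
def ballD (d k : ℕ) : ℕ := (k + d).choose d

lemma ballD_mono (d : ℕ) : Monotone (ballD d) := fun _ _ h =>
  Nat.choose_le_choose d (Nat.add_le_add_right h d)

lemma factorial_mul_ballD (d k : ℕ) : d.factorial * ballD d k = (k + 1).ascFactorial d :=
  (Nat.ascFactorial_eq_factorial_mul_choose k d).symm

lemma succ_pow_le_factorial_mul_ballD (d k : ℕ) : (k + 1) ^ d ≤ d.factorial * ballD d k :=
  factorial_mul_ballD d k ▸ Nat.pow_succ_le_ascFactorial (k + 1) d

lemma factorial_mul_ballD_le_pow (d k : ℕ) : d.factorial * ballD d k ≤ (k + d) ^ d :=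
  factorial_mul_ballD d k ▸ Nat.ascFactorial_le_pow_add k d

/-- An index `k` of the degree containing the `n`-th polynomial tends to infinity with `n`. -/
lemma tendsto_atTop_of_le_ballD {d : ℕ} {kf : ℕ → ℕ}
    (h : ∀ n : ℕ, 1 ≤ n → n ≤ ballD d (kf n)) :
    Filter.Tendsto kf Filter.atTop Filter.atTop := by
  refine Filter.tendsto_atTop.2 fun b => ?_
  filter_upwards [Filter.eventually_gt_atTop (ballD d b)] with n hn
  by_contra! hlt
  have h₁ := h n (by omega)
  have h₂ := ballD_mono d hlt.le
  omega

/-- The sandwich `k ^ d ≤ d! * n ≤ (k + d) ^ d` gives `d! * n / k ^ d → 1`. -/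
lemma tendsto_factorial_mul_div_pow {d : ℕ} {kf : ℕ → ℕ}
    (hkf : ∀ n : ℕ, 1 ≤ n →
      n ≤ ballD d (kf n) ∧ (0 < kf n → ballD d (kf n - 1) < n)) :
    Filter.Tendsto (fun n : ℕ => (d.factorial : ℝ) * n / (kf n : ℝ) ^ d) Filter.atTop
      (nhds 1) := by
  have hk := tendsto_atTop_of_le_ballD fun n hn => (hkf n hn).1
  have hupper : Filter.Tendsto (fun n : ℕ => (1 + (d : ℝ) / (kf n : ℝ)) ^ d) Filter.atTop
      (nhds 1) := by
    have h := ((((tendsto_const_div_atTop_nhds_zero_nat (d : ℝ)).comp hk).const_add 1).pow d)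
    simpa using h
  refine tendsto_of_tendsto_of_tendsto_of_le_of_le' tendsto_const_nhds hupper ?_ ?_
  all_goals
    filter_upwards [Filter.eventually_ge_atTop 1, hk.eventually_ge_atTop 1] with n hn hkn
    have hkpos : (0 : ℝ) < kf n := by exact_mod_cast hkn
    obtain ⟨hle, hlt⟩ := hkf n hn
  · rw [le_div_iff₀ (by positivity), one_mul]
    have h₁ := succ_pow_le_factorial_mul_ballD d (kf n - 1)
    rw [Nat.sub_add_cancel hkn] at h₁
    exact_mod_cast h₁.trans (Nat.mul_le_mul_left _ (hlt hkn).le)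
  · rw [one_add_div hkpos.ne', div_pow]
    gcongr
    exact_mod_cast (Nat.mul_le_mul_left _ hle).trans (factorial_mul_ballD_le_pow d (kf n))

/-- Theorem 6.2: if `λ_k · k^s → 1`, then
`n^{s/d} · λ_{k̃(d,n)} → (1/d!)^{s/d}`, where `k̃(d,n)` is the unique `k` with
`D(d,k−1) < n ≤ D(d,k)` (with `D(d,−1) = 0`). -/
theorem strong_equivalence_sobolev_ball
    (d : ℕ) (hd : 1 ≤ d) (s : ℝ) (hs : 0 < s)
    (lam : ℕ → ℝ) (hpos : ∀ k, 0 < lam k)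
    (hmono : ∀ j k : ℕ, j ≤ k → lam k ≤ lam j)
    (hlim : Filter.Tendsto (fun k : ℕ => lam k * (k : ℝ) ^ s) Filter.atTop (nhds 1))
    (kf : ℕ → ℕ)
    (hkf : ∀ n : ℕ, 1 ≤ n →
      n ≤ ballD d (kf n) ∧ (0 < kf n → ballD d (kf n - 1) < n)) :
    Filter.Tendsto (fun n : ℕ => (n : ℝ) ^ (s / (d : ℝ)) * lam (kf n)) Filter.atTop
      (nhds ((1 / (Nat.factorial d : ℝ)) ^ (s / (d : ℝ)))) := by
  have hk := tendsto_atTop_of_le_ballD fun n hn => (hkf n hn).1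
  have hd' : (d : ℝ) ≠ 0 := by positivity
  have hratio : Filter.Tendsto (fun n : ℕ => (n : ℝ) / (kf n : ℝ) ^ d) Filter.atTop
      (nhds (1 / (d.factorial : ℝ))) := by
    refine ((tendsto_factorial_mul_div_pow hkf).div_const (d.factorial : ℝ)).congr fun n => ?_
    have : (d.factorial : ℝ) ≠ 0 := by positivity
    field_simp
  have hprod := (hratio.rpow_const (p := s / d) (Or.inr (by positivity))).mul (hlim.comp hk)
  rw [mul_one] at hprod
  refine hprod.congr' ?_
  filter_upwards [hk.eventually_ge_atTop 1] with n hkn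
  have hkpos : (0 : ℝ) < kf n := by exact_mod_cast hkn
  have hpow : ((kf n : ℝ) ^ d) ^ (s / (d : ℝ)) = (kf n : ℝ) ^ s := by
    rw [← Real.rpow_natCast_mul hkpos.le, mul_div_cancel₀ s hd']
  have hne : (kf n : ℝ) ^ s ≠ 0 := (Real.rpow_pos_of_pos hkpos s).ne'
  simp only [Function.comp_apply]
  rw [Real.div_rpow (by positivity) (by positivity), hpow]
  field_simp
end
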